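/- The map φ, defined by reading the leaves of a plane binary tree left to right as a lattice path (right step for each left-child leaf, up step for each right-child leaf), forming the Young diagram bounded by this path, embedding the rotated tree into the diagram, and placing a 1 in each cell containing an internal vertex both of whose subtree edges exit through the cell's right and bottom edges (pattern cell) and 0 elsewhere, is a bijection from T_n onto the set of Catalan tableaux of index n+1. -/

import Mathlib

/-- Plane binary trees: every internal vertex has exactly two ordered children. -/
inductive PTree where
  | leaf : PTree
  | node : PTree → PTree → PTree
  deriving DecidableEq

namespace PTree

/-- number of leaves (endpoints) -/
def numLeaves : PTree → ℕ
  | leaf => 1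
  | node l r => numLeaves l + numLeaves r

/-- directions of the leaves of a subtree which is itself a `b`-child
(`true` = left child, `false` = right child), in left-to-right order. -/
def dirsAux : PTree → Bool → List Bool
  | leaf, b => [b]
  | node l r, _ => dirsAux l true ++ dirsAux r false

/-- the left/right-child directions of all leaves of a tree, left to right
(`true` = left child, `false` = right child). -/
def dirs : PTree → List Bool
  | leaf => []
  | node l r => dirsAux l true ++ dirsAux r false

/-- The reduction map `R`: the directions of the 2nd through (n+1)-th leaves;
`true` = • (occupied site, left child), `false` = ∘ (empty site, right child). -/
def red (T : PTree) : List Bool := ((dirs T).drop 1).dropLast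

/-- number of internal vertices on the path from the leftmost leaf to the root
(root included). -/
def lCount : PTree → ℕ
  | leaf => 0
  | node l _ => lCount l + 1

/-- number of internal vertices on the path from the rightmost leaf to the root
(root included). -/
def rCount : PTree → ℕ
  | leaf => 0
  | node _ r => rCount r + 1

/-- number of last branching vertices (internal vertices whose two children are leaves). -/
def lbCount : PTree → ℕ
  | leaf => 0
  | node leaf leaf => 1
  | node l r => lbCount l + lbCount r

end PTree

/-- Marked plane binary trees: a plane binary tree with exactly one of its
last branching vertices marked (the constructor `mark` is the marked vertex,
a vertex with two leaf children). -/
inductive MTree where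
  | mark : MTree
  | nodeL : MTree → PTree → MTree
  | nodeR : PTree → MTree → MTree
  deriving DecidableEq

namespace MTree

/-- forgetful map to plane binary trees -/
def forget : MTree → PTree
  | mark => .node .leaf .leaf
  | nodeL l r => .node (forget l) r
  | nodeR l r => .node l (forget r)

/-- collapse the marked vertex (with its two leaf children) to a single leaf. -/
def collapseT : MTree → PTree
  | mark => .leaf
  | nodeL l r => .node (collapseT l) r
  | nodeR l r => .node l (collapseT r)

/-- index (left to right, starting from 0) of the leaf of `collapseT` obtained
by collapsing the marked vertex. -/
def markIdx : MTree → ℕ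
  | mark => 0
  | nodeL l _ => markIdx l
  | nodeR l r => l.numLeaves + markIdx r

end MTree

/-- replace the `i`-th leaf of a tree by a marked last branching vertex. -/
def expand : PTree → ℕ → MTree
  | .leaf, _ => .mark
  | .node l r, i =>
      if i < l.numLeaves then .nodeL (expand l i) r
      else .nodeR l (expand r (i - l.numLeaves))

/-- index of the next right-child (`false`) leaf strictly after position `i`;
if there is none, the index of the rightmost left-child (`true`) leaf. -/
def nextFalseIdx (w : List Bool) (i : ℕ) : ℕ :=
  if (w.drop (i+1)).findIdx (fun b => !b) < (w.drop (i+1)).length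
  then i + 1 + (w.drop (i+1)).findIdx (fun b => !b)
  else w.length - 1 - (w.reverse.findIdx (fun b => b))

/-- index of the closest left-child (`true`) leaf strictly before position `i`;
if there is none, the index of the leftmost right-child (`false`) leaf. -/
def prevTrueIdx (w : List Bool) (i : ℕ) : ℕ :=
  if ((w.take i).reverse).findIdx (fun b => b) < i
  then i - 1 - ((w.take i).reverse).findIdx (fun b => b)
  else w.findIdx (fun b => !b)

/-- position of the leaf where the removed segment is re-glued by `π`. -/
def target (w : List Bool) (i : ℕ) : ℕ :=
  if w.getD i true then prevTrueIdx w i else nextFalseIdx w i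

/-- The map `π` on marked trees: remove the segment joining the marked vertex to
its left (resp. right) leaf when the marked vertex is a right (resp. left) child,
and glue it to the next right- (resp. left-) child leaf to the right (resp. left),
with the boundary rule when no such leaf exists; the new vertex is marked. -/
def piM (M : MTree) : MTree :=
  expand M.collapseT (target M.collapseT.dirs M.markIdx)

open Classical in
/-- Transition rates of the `n`-site open-boundary TASEP, on configurations
encoded as lists of booleans (`true` = •, `false` = ∘). -/
noncomputable def rate (α β : ℝ) (C C' : List Bool) : ℝ :=
  if ∃ A, C = false :: A ∧ C' = true :: A then α
  else if ∃ A, C = A ++ [true] ∧ C' = A ++ [false] then β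
  else if ∃ A A', C = A ++ true :: false :: A' ∧ C' = A ++ false :: true :: A' then 1
  else 0

/-- number of active bonds of a configuration: injection at site 1 if empty,
extraction at site n if occupied, and hops across •∘ pairs. -/
def activeCount (C : List Bool) : ℕ :=
  (if C.head? = some false then 1 else 0) +
  ((C.zip C.tail).count (true, false)) +
  (if C.getLast? = some true then 1 else 0)

/-- the weight `μ(T) = α^{-l(T)} β^{-r(T)}` of a plane binary tree. -/
noncomputable def mu (α β : ℝ) (T : PTree) : ℝ :=
  α ^ (-(T.lCount : ℤ)) * β ^ (-(T.rCount : ℤ))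

/-- number of internal vertices on the path from the leftmost leaf to the root,
excluding the marked vertex. -/
def lCountM : MTree → ℕ
  | .mark => 0
  | .nodeL l _ => lCountM l + 1
  | .nodeR l _ => l.lCount + 1

/-- number of internal vertices on the path from the rightmost leaf to the root,
excluding the marked vertex. -/
def rCountM : MTree → ℕ
  | .mark => 0
  | .nodeR _ r => rCountM r + 1
  | .nodeL _ r => r.rCount + 1

/-- the weight `μ̂` of a marked tree, excluding the marked vertex from the counts. -/
noncomputable def muHat (α β : ℝ) (M : MTree) : ℝ :=
  α ^ (-(lCountM M : ℤ)) * β ^ (-(rCountM M : ℤ))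

namespace PTree

/-- number of left-child (`true`) leaves of a subtree which is a `b`-child. -/
def cntT : PTree → Bool → ℕ
  | leaf, b => if b then 1 else 0
  | node l r, _ => cntT l true + cntT r false

/-- number of right-child (`false`) leaves of a subtree which is a `b`-child. -/
def cntF : PTree → Bool → ℕ
  | leaf, b => if b then 0 else 1
  | node l r, _ => cntF l true + cntF r false

/-- For each internal vertex of a subtree (a `b`-child, with `t0` left-child
leaves and `f0` right-child leaves strictly to its left) which is itself a right
child, record the pair (1-based index of the leftmost leaf of its subtree among
all left-child leaves, 1-based index of the rightmost leaf of its subtree among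
all right-child leaves).  These data locate the internal vertices which are right
children inside the Young diagram when the rotated tree is embedded in it. -/
def rcPairs : PTree → Bool → ℕ → ℕ → List (ℕ × ℕ)
  | leaf, _, _, _ => []
  | node l r, b, t0, f0 =>
      (if b then [] else [(t0 + 1, f0 + cntF (node l r) false)]) ++
      rcPairs l true t0 f0 ++ rcPairs r false (t0 + cntT l true) (f0 + cntF l true)

/-- The cells of the tableau `φ(T)` containing a 1: in the embedding of the
rotated tree in the Young diagram, an internal vertex lies in the cell whose
column is that of the first right step of its subtree's portion of the lattice
path and whose row is that of its last up step; the 1s are the cells containing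
the pattern (an internal vertex both of whose subtree edges leave through the
right and bottom edges of the cell). -/
def rcCells : PTree → List (ℕ × ℕ)
  | leaf => []
  | node l r =>
      (rcPairs l true 0 0 ++ rcPairs r false (cntT l true) (cntF l true)).map
        (fun p => ((dirs (node l r)).count false - p.2, p.1 - 1))

/-- index in `w` of the `k`-th (1-based) `false` entry. -/
def fIdx (w : List Bool) (k : ℕ) : ℕ :=
  ((List.range w.length).filter (fun i => w.getD i true = false)).getD (k - 1) 0

/-- number of `true` entries before the `k`-th `false` entry:
the length of the corresponding row of the Young diagram. -/
def tBefore (w : List Bool) (k : ℕ) : ℕ := (w.take (fIdx w k)).count true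

/-- the cells of the Young diagram `λ(T)` determined by the lattice path reading
the leaves of `T` (right step for a left-child leaf, up step for a right-child
leaf), in matrix coordinates (row from top, column from left). -/
def shapeCells (T : PTree) : Finset (ℕ × ℕ) :=
  ((Finset.range ((dirs T).count false)) ×ˢ (Finset.range ((dirs T).count true))).filter
    (fun c => c.2 + 1 ≤ tBefore (dirs T) ((dirs T).count false - c.1))

end PTree


/-- A Catalan tableau: a Young diagram (in English notation, rows downwards)
filled with 0/1 (`true` = 1) such that every column except the leftmost contains
exactly one 1, the leftmost column contains no 1, and no 0 has both a 1 above it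
in its column and a 1 to its left in its row. -/
structure CatalanTableau where
  shape : YoungDiagram
  filling : ℕ × ℕ → Bool
  supp : ∀ c, c ∉ shape → filling c = false
  shape_nonempty : shape.cells.Nonempty
  leftCol : ∀ i, filling (i, 0) = false
  colHasOne : ∀ j, 0 < j → j < shape.rowLen 0 → ∃! i, filling (i, j) = true
  noBadZero : ∀ i j, (i, j) ∈ shape → filling (i, j) = false →
      (∃ i' < i, filling (i', j) = true) → ¬ ∃ j' < j, filling (i, j') = true

/-- the index of a Catalan tableau: (number of rows) + (number of columns) - 1. -/
def CatalanTableau.index (t : CatalanTableau) : ℕ :=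
  t.shape.colLen 0 + t.shape.rowLen 0 - 1


namespace PTree

lemma numLeaves_pos (T : PTree) : 0 < T.numLeaves := by
  induction T with
  | leaf => simp [numLeaves]
  | node l r hl hr => simp only [numLeaves]; omega

lemma numLeaves_eq_one_iff (T : PTree) : T.numLeaves = 1 ↔ T = leaf := by
  cases T with
  | leaf => simp [numLeaves]
  | node l r =>
    have := numLeaves_pos l
    have := numLeaves_pos r
    simp only [numLeaves, reduceCtorEq, iff_false]
    omega

lemma length_dirsAux (T : PTree) (b : Bool) : (dirsAux T b).length = T.numLeaves := by
  induction T generalizing b with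
  | leaf => simp [numLeaves, dirsAux]
  | node l r hl hr => simp [numLeaves, dirsAux, hl, hr]

lemma dirsAux_eq_dirs {T : PTree} (hT : T ≠ leaf) (b : Bool) : dirsAux T b = dirs T := by
  cases T with
  | leaf => exact absurd rfl hT
  | node l r => rfl

/-- `Arc T p s e`: with the leaves of `T` numbered from `p` on, some internal vertex of `T`,
different from the root and a right child, has exactly the leaves `s, …, e - 1` below it. -/
def Arc : PTree → ℕ → ℕ → ℕ → Prop
  | leaf, _, _, _ => False
  | node l r, p, s, e =>
      Arc l p s e ∨ (r ≠ leaf ∧ s = p + l.numLeaves ∧ e = p + l.numLeaves + r.numLeaves) ∨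
        Arc r (p + l.numLeaves) s e

/-- The letters of `W` from position `p` on spell the leaf directions of the `b`-child `T`. -/
def Reads (W : ℕ → Bool) (T : PTree) (b : Bool) (p : ℕ) : Prop :=
  (List.range' p T.numLeaves).map W = dirsAux T b

lemma reads_leaf {W : ℕ → Bool} {b : Bool} {p : ℕ} : Reads W leaf b p ↔ W p = b := by
  simp [Reads, numLeaves, dirsAux]

lemma reads_node {W : ℕ → Bool} {l r : PTree} {b : Bool} {p : ℕ} :
    Reads W (node l r) b p ↔ Reads W l true p ∧ Reads W r false (p + l.numLeaves) := by
  unfold Reads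
  rw [numLeaves, dirsAux, ← List.range'_append, one_mul, List.map_append]
  constructor
  · intro h
    exact List.append_inj h (by simp [length_dirsAux])
  · rintro ⟨h₁, h₂⟩
    rw [h₁, h₂]

lemma Reads.of_ne_leaf {W : ℕ → Bool} {T : PTree} {b : Bool} {p : ℕ} (h : Reads W T b p)
    (hT : T ≠ leaf) (b' : Bool) : Reads W T b' p := by
  cases T with
  | leaf => exact absurd rfl hT
  | node l r => exact reads_node.2 (reads_node.1 h)

lemma Reads.first {W : ℕ → Bool} {T : PTree} {b : Bool} {p : ℕ} (h : Reads W T b p)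
    (hT : b = true ∨ T ≠ leaf) : W p = true := by
  induction T generalizing b p with
  | leaf =>
    rw [reads_leaf.1 h]
    simpa using hT
  | node l r hl hr => exact hl (reads_node.1 h).1 (Or.inl rfl)

lemma Reads.last {W : ℕ → Bool} {T : PTree} {b : Bool} {p : ℕ} (h : Reads W T b p)
    (hT : b = false ∨ T ≠ leaf) : W (p + T.numLeaves - 1) = false := by
  induction T generalizing b p with
  | leaf =>
    have : W p = b := reads_leaf.1 h
    simpa [numLeaves, this] using hT
  | node l r hl hr =>
    have := hr (reads_node.1 h).2 (Or.inl rfl)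
    rwa [add_assoc] at this

lemma Arc.bounds {T : PTree} {p s e : ℕ} (h : Arc T p s e) :
    p < s ∧ s + 1 < e ∧ e ≤ p + T.numLeaves := by
  induction T generalizing p with
  | leaf => exact h.elim
  | node l r hl hr =>
    have h₁ := numLeaves_pos l
    have h₂ := numLeaves_pos r
    simp only [numLeaves]
    rcases h with h | ⟨hne, rfl, rfl⟩ | h
    · have := hl h
      omega
    · have := mt (numLeaves_eq_one_iff r).1 hne
      omega
    · have := hr h
      omega

lemma Arc.letters {W : ℕ → Bool} {T : PTree} {b : Bool} {p s e : ℕ} (h : Arc T p s e)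
    (hW : Reads W T b p) : W s = true ∧ W (e - 1) = false := by
  induction T generalizing p b with
  | leaf => exact h.elim
  | node l r hl hr =>
    obtain ⟨h₁, h₂⟩ := reads_node.1 hW
    rcases h with h | ⟨hne, rfl, rfl⟩ | h
    · exact hl h h₁
    · exact ⟨h₂.first (Or.inr hne), h₂.last (Or.inr hne)⟩
    · exact hr h h₂

lemma Reads.exists_arc {W : ℕ → Bool} {T : PTree} {b : Bool} {p s : ℕ} (hW : Reads W T b p)
    (hs : W s = true) (h₁ : p < s) (h₂ : s < p + T.numLeaves) : ∃ e, Arc T p s e := by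
  induction T generalizing p b with
  | leaf =>
    simp only [numLeaves] at h₂
    omega
  | node l r hl hr =>
    simp only [numLeaves] at h₂
    obtain ⟨hWl, hWr⟩ := reads_node.1 hW
    rcases lt_trichotomy s (p + l.numLeaves) with h | h | h
    · obtain ⟨e, he⟩ := hl hWl h₁ h
      exact ⟨e, Or.inl he⟩
    · refine ⟨_, Or.inr (Or.inl ⟨?_, h, rfl⟩)⟩
      rintro rfl
      rw [reads_leaf, ← h, hs] at hWr
      exact absurd hWr (by simp)
    · obtain ⟨e, he⟩ := hr hWr h (by omega)
      exact ⟨e, Or.inr (Or.inr he)⟩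

lemma Arc.eq_end {T : PTree} {p s e e' : ℕ} (h : Arc T p s e) (h' : Arc T p s e') : e = e' := by
  induction T generalizing p with
  | leaf => exact h.elim
  | node l r hl hr =>
    rcases h with h | ⟨_, hs, he⟩ | h <;> rcases h' with h' | ⟨_, hs', he'⟩ | h'
    · exact hl h h'
    · have := h.bounds
      omega
    · have := h.bounds
      have := h'.bounds
      omega
    · have := h'.bounds
      omega
    · omega
    · have := h'.bounds
      omega
    · have := h.bounds
      have := h'.bounds
      omega
    · have := h.bounds
      omega
    · exact hr h h'

lemma Arc.noncrossing {T : PTree} {p s e s' e' : ℕ} (h : Arc T p s e) (h' : Arc T p s' e')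
    (h₁ : s < s') (h₂ : s' < e) : e' ≤ e := by
  induction T generalizing p with
  | leaf => exact h.elim
  | node l r hl hr =>
    rcases h with h | ⟨_, hs, he⟩ | h <;> rcases h' with h' | ⟨_, hs', he'⟩ | h'
    · exact hl h h'
    · have := h.bounds
      omega
    · have := h.bounds
      have := h'.bounds
      omega
    · have := h'.bounds
      omega
    · omega
    · have := h'.bounds
      omega
    · have := h.bounds
      have := h'.bounds
      omega
    · have := h.bounds
      omega
    · exact hr h h'

lemma numLeaves_left_le_of_arc {l r l' r' : PTree} {p : ℕ}
    (hn : (node l r).numLeaves = (node l' r').numLeaves)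
    (h : ∀ s e, Arc (node l r) p s e → Arc (node l' r') p s e) :
    l'.numLeaves ≤ l.numLeaves := by
  simp only [numLeaves] at hn
  have := numLeaves_pos r'
  by_cases hr : r = leaf
  · subst hr
    simp only [numLeaves] at hn
    omega
  · rcases h _ _ (Or.inr (Or.inl ⟨hr, rfl, rfl⟩)) with h | ⟨_, hs, _⟩ | h
    · have := h.bounds
      omega
    · omega
    · have := h.bounds
      omega

/-- A tree is determined by its number of leaves and its arcs. -/
lemma eq_of_arc_iff {T T' : PTree} {p : ℕ} (hn : T.numLeaves = T'.numLeaves)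
    (h : ∀ s e, Arc T p s e ↔ Arc T' p s e) : T = T' := by
  induction T generalizing T' p with
  | leaf => exact ((numLeaves_eq_one_iff T').1 hn.symm).symm
  | node l r hl hr =>
    cases T' with
    | leaf => exact absurd ((numLeaves_eq_one_iff _).1 hn) (by simp)
    | node l' r' =>
      have hL : l.numLeaves = l'.numLeaves :=
        le_antisymm (numLeaves_left_le_of_arc hn.symm fun s e => (h s e).2)
          (numLeaves_left_le_of_arc hn fun s e => (h s e).1)
      have hR : r.numLeaves = r'.numLeaves := by
        simp only [numLeaves] at hn
        omega
      have hleft : ∀ s e, Arc l p s e ↔ Arc l' p s e := by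
        intro s e
        constructor <;> intro ha
        · have hb := ha.bounds
          rcases (h s e).1 (Or.inl ha) with h' | h' | h'
          · exact h'
          · omega
          · have := h'.bounds
            omega
        · have hb := ha.bounds
          rcases (h s e).2 (Or.inl ha) with h' | h' | h'
          · exact h'
          · omega
          · have := h'.bounds
            omega
      have hright : ∀ s e, Arc r (p + l.numLeaves) s e ↔ Arc r' (p + l.numLeaves) s e := by
        intro s e
        constructor <;> intro ha
        · have hb := ha.bounds
          rcases (h s e).1 (Or.inr (Or.inr ha)) with h' | h' | h'
          · have := h'.bounds
            omega
          · omega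
          · rwa [← hL] at h'
        · have hb := ha.bounds
          rcases (h s e).2 (Or.inr (Or.inr (by rwa [← hL]))) with h' | h' | h'
          · have := h'.bounds
            omega
          · omega
          · exact h'
      rw [hl hL hleft, hr hR hright]

/-- Every noncrossing system of arcs on a segment, with one arc starting at each `true` letter
other than the first, comes from a tree. -/
lemma exists_tree {W : ℕ → Bool} {R : ℕ → ℕ → Prop}
    (hT : ∀ s e, R s e → W s = true) (hlt : ∀ s e, R s e → s + 1 < e)
    (huniq : ∀ s e e', R s e → R s e' → e = e')
    (hnc : ∀ s e s' e', R s e → R s' e' → s < s' → s' < e → e' ≤ e)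
    (N p : ℕ) (hN : 0 < N) (hp : W p = true)
    (hR : ∀ s, p < s → s < p + N → W s = true → ∃ e ≤ p + N, R s e) :
    ∃ T : PTree, T.numLeaves = N ∧ Reads W T true p ∧
      ∀ s e, Arc T p s e ↔ R s e ∧ p < s ∧ e ≤ p + N := by
  classical
  induction N using Nat.strong_induction_on generalizing p with
  | _ N ih =>
  obtain rfl | hN' : N = 1 ∨ 1 < N := by omega
  · refine ⟨leaf, rfl, reads_leaf.2 hp, fun s e => ⟨fun h => h.elim, ?_⟩⟩
    rintro ⟨h₁, h₂, h₃⟩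
    have := hlt _ _ h₁
    omega
  by_cases hE : ∃ s, p < s ∧ R s (p + N)
  · obtain ⟨hps, hs⟩ := Nat.find_spec hE
    have hmin : ∀ m, p < m → m < Nat.find hE → ¬ R m (p + N) :=
      fun m h₁ h₂ h₃ => Nat.find_min hE h₂ ⟨h₁, h₃⟩
    generalize Nat.find hE = s at hps hs hmin
    have hsE := hlt _ _ hs
    have hshort : ∀ s' e', R s' e' → p < s' → s' < s → e' ≤ p + N → e' ≤ s := by
      intro s' e' h h₁ h₂ h₃
      by_contra hlt'
      have := hnc _ _ _ _ h hs h₂ (by omega)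
      obtain rfl : e' = p + N := by omega
      exact hmin _ h₁ h₂ h
    obtain ⟨l, hln, hlW, hlA⟩ := ih (s - p) (by omega) p (by omega) hp (by
      intro s' h₁ h₂ h₃
      obtain ⟨e, he, hRe⟩ := hR s' h₁ (by omega) h₃
      have := hshort s' e hRe h₁ (by omega) he
      exact ⟨e, by omega, hRe⟩)
    obtain ⟨r, hrn, hrW, hrA⟩ := ih (p + N - s) (by omega) s (by omega) (hT _ _ hs) (by
      intro s' h₁ h₂ h₃
      obtain ⟨e, he, hRe⟩ := hR s' (by omega) (by omega) h₃
      exact ⟨e, by omega, hRe⟩)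
    have hne : r ≠ leaf := by
      rintro rfl
      simp only [numLeaves] at hrn
      omega
    have hpl : p + l.numLeaves = s := by omega
    refine ⟨node l r, by simp only [numLeaves]; omega,
      reads_node.2 ⟨hlW, by rw [hpl]; exact hrW.of_ne_leaf hne _⟩, fun s' e' => ?_⟩
    rw [Arc, hpl, hlA, hrA]
    constructor
    · rintro (⟨h₁, h₂, h₃⟩ | ⟨_, rfl, rfl⟩ | ⟨h₁, h₂, h₃⟩)
      · exact ⟨h₁, h₂, by omega⟩
      · have : s' + r.numLeaves = p + N := by omega
        rw [this]
        exact ⟨hs, hps, le_rfl⟩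
      · exact ⟨h₁, by omega, by omega⟩
    · rintro ⟨h₁, h₂, h₃⟩
      rcases lt_trichotomy s' s with h | rfl | h
      · have := hshort _ _ h₁ h₂ h h₃
        exact Or.inl ⟨h₁, h₂, by omega⟩
      · have := huniq _ _ _ h₁ hs
        exact Or.inr (Or.inl ⟨hne, rfl, by omega⟩)
      · exact Or.inr (Or.inr ⟨h₁, h, by omega⟩)
  · push Not at hE
    have hne : ∀ s e, p < s → R s e → e ≠ p + N := by
      rintro s e h₁ h₂ rfl
      exact hE s h₁ h₂
    obtain ⟨l, hln, hlW, hlA⟩ := ih (N - 1) (by omega) p (by omega) hp (by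
      intro s h₁ h₂ h₃
      obtain ⟨e, he, hRe⟩ := hR s h₁ (by omega) h₃
      have := hne _ _ h₁ hRe
      exact ⟨e, by omega, hRe⟩)
    have hlast : W (p + l.numLeaves) = false := by
      by_contra h
      obtain ⟨e, he, hRe⟩ := hR (p + l.numLeaves) (by omega) (by omega) (by simpa using h)
      have := hlt _ _ hRe
      omega
    refine ⟨node l leaf, by simp only [numLeaves]; omega,
      reads_node.2 ⟨hlW, reads_leaf.2 hlast⟩, fun s e => ?_⟩
    rw [Arc, hlA]
    constructor
    · rintro (⟨h₁, h₂, h₃⟩ | h | h)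
      · exact ⟨h₁, h₂, by omega⟩
      · exact absurd rfl h.1
      · exact h.elim
    · rintro ⟨h₁, h₂, h₃⟩
      have := hne _ _ h₂ h₁
      exact Or.inl ⟨h₁, h₂, by omega⟩

/-- The number of letters `x` among the first `k` letters of `W`. -/
abbrev cnt (W : ℕ → Bool) (x : Bool) (k : ℕ) : ℕ := Nat.count (fun i => W i = x) k

lemma cnt_mono (W : ℕ → Bool) (x : Bool) {k k' : ℕ} (h : k ≤ k') : cnt W x k ≤ cnt W x k' :=
  Nat.count_monotone _ h

lemma cnt_lt {W : ℕ → Bool} {x : Bool} {k k' : ℕ} (hk : W k = x) (h : k < k') :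
    cnt W x k < cnt W x k' :=
  Nat.count_strict_mono hk h

lemma cnt_succ_eq {W : ℕ → Bool} {x : Bool} {k : ℕ} (hk : W k = x) :
    cnt W x (k + 1) = cnt W x k + 1 := by
  simp [cnt, Nat.count_succ, hk]

lemma cnt_inj {W : ℕ → Bool} {x : Bool} {k k' : ℕ} (hk : W k = x) (hk' : W k' = x)
    (h : cnt W x k = cnt W x k') : k = k' :=
  Nat.count_injective hk hk' h

lemma cnt_true_add_cnt_false (W : ℕ → Bool) (k : ℕ) : cnt W true k + cnt W false k = k := by
  induction k with
  | zero => simp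
  | succ k ih =>
    simp only [cnt, Nat.count_succ] at ih ⊢
    cases W k <;> simp <;> omega

lemma exists_cnt_eq {W : ℕ → Bool} {x : Bool} {N j : ℕ} (h : j < cnt W x N) :
    ∃ k < N, W k = x ∧ cnt W x k = j := by
  induction N with
  | zero => simp at h
  | succ N ih =>
    by_cases hj : j < cnt W x N
    · obtain ⟨k, hk, h'⟩ := ih hj
      exact ⟨k, by omega, h'⟩
    · by_cases hW : W N = x
      · rw [cnt_succ_eq hW] at h
        exact ⟨N, by omega, hW, by omega⟩
      · simp [cnt, Nat.count_succ, hW] at h hj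
        omega

lemma Reads.cnt_end {W : ℕ → Bool} {T : PTree} {b : Bool} {p : ℕ} (h : Reads W T b p) :
    cnt W true (p + T.numLeaves) = cnt W true p + cntT T b ∧
      cnt W false (p + T.numLeaves) = cnt W false p + cntF T b := by
  induction T generalizing b p with
  | leaf =>
    have := reads_leaf.1 h
    cases b <;> simp [numLeaves, cntT, cntF, cnt, Nat.count_succ, this]
  | node l r hl hr =>
    obtain ⟨h₁, h₂⟩ := reads_node.1 h
    have := hl h₁
    have := hr h₂
    simp only [numLeaves, cntT, cntF, ← add_assoc]
    omega

lemma Reads.mem_rcPairs {W : ℕ → Bool} {T : PTree} {b : Bool} {p : ℕ} (h : Reads W T b p)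
    (x : ℕ × ℕ) :
    x ∈ rcPairs T b (cnt W true p) (cnt W false p) ↔
      (b = false ∧ T ≠ leaf ∧ x = (cnt W true p + 1, cnt W false (p + T.numLeaves))) ∨
        ∃ s e, Arc T p s e ∧ x = (cnt W true s + 1, cnt W false e) := by
  induction T generalizing b p with
  | leaf => simp [rcPairs, Arc]
  | node l r hl hr =>
    obtain ⟨h₁, h₂⟩ := reads_node.1 h
    have hc := h₁.cnt_end
    have hr' := hr h₂
    rw [hc.1, hc.2] at hr'
    have htop : cnt W false (p + (node l r).numLeaves) =
        cnt W false p + cntF (node l r) false := by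
      rw [(h.of_ne_leaf (by simp) false).cnt_end.2]
    rw [rcPairs, List.mem_append, List.mem_append, hl h₁, hr', htop]
    have hfst : (x ∈ if b = true then []
          else [(cnt W true p + 1, cnt W false p + cntF (node l r) false)]) ↔
        b = false ∧ x = (cnt W true p + 1, cnt W false p + cntF (node l r) false) := by
      cases b <;> simp
    rw [hfst]
    constructor
    · rintro ((⟨hb, hx⟩ | ⟨hb, _⟩ | ⟨s, e, ha, hx⟩) | ⟨_, hne, hx⟩ | ⟨s, e, ha, hx⟩)
      · exact Or.inl ⟨hb, by simp, hx⟩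
      · exact absurd hb (by simp)
      · exact Or.inr ⟨s, e, Or.inl ha, hx⟩
      · exact Or.inr ⟨_, _, Or.inr (Or.inl ⟨hne, rfl, rfl⟩), by rw [hx, hc.1]⟩
      · exact Or.inr ⟨s, e, Or.inr (Or.inr ha), hx⟩
    · rintro (⟨hb, _, hx⟩ | ⟨s, e, ha | ⟨hne, rfl, rfl⟩ | ha, hx⟩)
      · exact Or.inl (Or.inl ⟨hb, hx⟩)
      · exact Or.inl (Or.inr (Or.inr ⟨s, e, ha, hx⟩))
      · exact Or.inr (Or.inl ⟨rfl, hne, by rw [hx, hc.1]⟩)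
      · exact Or.inr (Or.inr ⟨s, e, ha, hx⟩)

lemma Reads.count_take {W : ℕ → Bool} {T : PTree} {b : Bool} (h : Reads W T b 0) (x : Bool)
    {k : ℕ} (hk : k ≤ T.numLeaves) : ((dirsAux T b).take k).count x = cnt W x k := by
  rw [← h, ← List.map_take, List.take_range'_of_length_ge hk]
  clear h hk
  induction k with
  | zero => simp
  | succ k ih =>
    rw [List.range'_concat, List.map_append, List.count_append, ih]
    by_cases hx : W k = x <;> simp [cnt, Nat.count_succ, hx]

lemma Reads.count_eq {W : ℕ → Bool} {T : PTree} {b : Bool} (h : Reads W T b 0) (x : Bool) :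
    (dirsAux T b).count x = cnt W x T.numLeaves := by
  rw [← h.count_take x le_rfl, List.take_of_length_le (length_dirsAux T b).le]

lemma Reads.getD_eq {W : ℕ → Bool} {T : PTree} {b : Bool} (h : Reads W T b 0) {k : ℕ}
    (hk : k < T.numLeaves) (d : Bool) : (dirsAux T b).getD k d = W k := by
  rw [← h]
  simp [List.getD_eq_getElem?_getD, hk]

lemma getD_filter_range {P : ℕ → Prop} [DecidablePred P] {N q : ℕ} (hq : q < N) (hP : P q) :
    ((List.range N).filter (fun i => decide (P i))).getD (Nat.count P q) 0 = q := by
  have hlen : ((List.range q).filter (fun i => decide (P i))).length = Nat.count P q := by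
    rw [Nat.count, List.countP_eq_length_filter]
  obtain ⟨m, rfl⟩ : ∃ m, N = q + (m + 1) := ⟨N - q - 1, by omega⟩
  rw [List.range_add, List.filter_append, List.getD_append_right _ _ _ _ hlen.le, hlen,
    List.range_succ_eq_map]
  simp [hP]

lemma Reads.tBefore_eq {W : ℕ → Bool} {T : PTree} {b : Bool} (h : Reads W T b 0) {q : ℕ}
    (hq : q < T.numLeaves) (hW : W q = false) :
    tBefore (dirsAux T b) (cnt W false q + 1) = cnt W true q := by
  have hf : fIdx (dirsAux T b) (cnt W false q + 1) = q := by
    have hfilter : (List.range T.numLeaves).filter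
          (fun i => decide ((dirsAux T b).getD i true = false)) =
        (List.range T.numLeaves).filter (fun i => decide (W i = false)) :=
      List.filter_congr fun i hi => by rw [h.getD_eq (List.mem_range.1 hi)]
    rw [fIdx, length_dirsAux, Nat.add_sub_cancel, hfilter]
    exact getD_filter_range (P := fun i => W i = false) hq hW
  rw [tBefore, hf, h.count_take _ hq.le]

lemma Reads.mem_shapeCells {W : ℕ → Bool} {T : PTree} (h : Reads W T true 0) (hT : T ≠ leaf)
    (i j : ℕ) : (i, j) ∈ shapeCells T ↔
      ∃ q < T.numLeaves, W q = false ∧ i + cnt W false q + 1 = cnt W false T.numLeaves ∧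
        j < cnt W true q := by
  rw [shapeCells, ← dirsAux_eq_dirs hT true, h.count_eq, h.count_eq]
  simp only [Finset.mem_filter, Finset.mem_product, Finset.mem_range]
  constructor
  · rintro ⟨⟨hi, hj⟩, hle⟩
    obtain ⟨q, hq, hWq, hc⟩ :=
      exists_cnt_eq (W := W) (x := false) (N := T.numLeaves) (j := cnt W false T.numLeaves - i - 1)
        (by omega)
    refine ⟨q, hq, hWq, by omega, ?_⟩
    rw [show cnt W false T.numLeaves - i = cnt W false q + 1 by omega, h.tBefore_eq hq hWq] at hle
    omega
  · rintro ⟨q, hq, hWq, hi, hj⟩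
    have := cnt_mono W true hq.le
    refine ⟨⟨by omega, by omega⟩, ?_⟩
    rw [show cnt W false T.numLeaves - i = cnt W false q + 1 by omega, h.tBefore_eq hq hWq]
    omega

lemma Reads.mem_rcCells {W : ℕ → Bool} {T : PTree} (h : Reads W T true 0) (hT : T ≠ leaf)
    (c : ℕ × ℕ) : c ∈ rcCells T ↔
      ∃ s e, Arc T 0 s e ∧ c.1 + cnt W false e = cnt W false T.numLeaves ∧ c.2 = cnt W true s := by
  cases T with
  | leaf => exact absurd rfl hT
  | node l r =>
    have hp : rcPairs l true 0 0 ++ rcPairs r false (cntT l true) (cntF l true) =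
        rcPairs (node l r) true (cnt W true 0) (cnt W false 0) := by
      simp [rcPairs]
    rw [rcCells, hp, ← dirsAux_eq_dirs hT true, h.count_eq]
    simp only [List.mem_map, h.mem_rcPairs, reduceCtorEq, false_and, false_or]
    constructor
    · rintro ⟨_, ⟨s, e, ha, rfl⟩, rfl⟩
      have hb := ha.bounds
      have := cnt_mono W false (show e ≤ (node l r).numLeaves by omega)
      exact ⟨s, e, ha, by simp only; omega, by simp⟩
    · rintro ⟨s, e, ha, h₁, h₂⟩
      exact ⟨_, ⟨s, e, ha, rfl⟩, Prod.ext (by simp only; omega) (by simp only; omega)⟩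

/-- The leaf directions of `T` as an infinite word. -/
def word (T : PTree) (k : ℕ) : Bool := (dirs T).getD k true

lemma reads_word {T : PTree} (hT : T ≠ leaf) : Reads (word T) T true 0 := by
  have hw : word T = fun k => (dirsAux T true).getD k true := by
    funext k
    rw [word, dirsAux_eq_dirs hT]
  rw [Reads, hw, ← length_dirsAux T true]
  refine List.ext_getElem (by simp) fun k h₁ h₂ => ?_
  simp [List.getD_eq_getElem?_getD, h₂]

lemma Reads.zero_mem_shapeCells {W : ℕ → Bool} {T : PTree} (h : Reads W T true 0) (hT : T ≠ leaf)
    (i : ℕ) : (i, 0) ∈ shapeCells T ↔ i < cnt W false T.numLeaves := by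
  rw [h.mem_shapeCells hT]
  constructor
  · rintro ⟨q, _, _, hi, _⟩
    omega
  · intro hi
    obtain ⟨q, hq, hWq, hc⟩ :=
      exists_cnt_eq (W := W) (x := false) (N := T.numLeaves) (j := cnt W false T.numLeaves - i - 1)
        (by omega)
    have h0 : W 0 = true := h.first (Or.inl rfl)
    have hq0 : 0 < q := by
      rcases Nat.eq_zero_or_pos q with rfl | h'
      · simp [h0] at hWq
      · exact h'
    have := cnt_lt h0 hq0
    exact ⟨q, hq, hWq, by omega, by omega⟩

lemma Reads.mem_shapeCells_zero {W : ℕ → Bool} {T : PTree} (h : Reads W T true 0) (hT : T ≠ leaf)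
    (j : ℕ) : (0, j) ∈ shapeCells T ↔ j < cnt W true T.numLeaves := by
  have hpos := numLeaves_pos T
  rw [h.mem_shapeCells hT]
  constructor
  · rintro ⟨q, hq, _, _, hj⟩
    exact hj.trans_le (cnt_mono W true hq.le)
  · intro hj
    have hl : W (T.numLeaves - 1) = false := by simpa using h.last (Or.inr hT)
    have h₁ := cnt_succ_eq hl
    have h₂ := cnt_true_add_cnt_false W (T.numLeaves - 1)
    have h₃ := cnt_true_add_cnt_false W T.numLeaves
    rw [Nat.sub_add_cancel hpos] at h₁
    exact ⟨T.numLeaves - 1, by omega, hl, by omega, by omega⟩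

/-- The Young diagram below the lattice path of `T`. -/
def diagram (T : PTree) (hT : T ≠ leaf) : YoungDiagram where
  cells := shapeCells T
  isLowerSet := by
    rintro ⟨i, j⟩ ⟨i', j'⟩ hle hm
    obtain ⟨hi : i' ≤ i, hj : j' ≤ j⟩ := hle
    have h := reads_word hT
    rw [Finset.mem_coe, h.mem_shapeCells hT] at hm ⊢
    obtain ⟨q, hq, hWq, hc, hlt⟩ := hm
    obtain ⟨q', hq', hWq', hc'⟩ := exists_cnt_eq (W := word T) (x := false) (N := T.numLeaves)
      (j := cnt (word T) false T.numLeaves - i' - 1) (by omega)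
    have hqq : q ≤ q' := by
      by_contra hlt'
      have := cnt_lt hWq' (show q' < q by omega)
      omega
    have := cnt_mono (word T) true hqq
    exact ⟨q', hq', hWq', by omega, by omega⟩

lemma mem_diagram {T : PTree} (hT : T ≠ leaf) (c : ℕ × ℕ) :
    c ∈ diagram T hT ↔ c ∈ shapeCells T := Iff.rfl

lemma rowLen_diagram {T : PTree} (hT : T ≠ leaf) :
    (diagram T hT).rowLen 0 = cnt (word T) true T.numLeaves :=
  eq_of_forall_lt_iff fun j => by
    rw [← YoungDiagram.mem_iff_lt_rowLen, mem_diagram, (reads_word hT).mem_shapeCells_zero hT]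

lemma colLen_diagram {T : PTree} (hT : T ≠ leaf) :
    (diagram T hT).colLen 0 = cnt (word T) false T.numLeaves :=
  eq_of_forall_lt_iff fun i => by
    rw [← YoungDiagram.mem_iff_lt_colLen, mem_diagram, (reads_word hT).zero_mem_shapeCells hT]

lemma Reads.cnt_arc_end {W : ℕ → Bool} {T : PTree} (h : Reads W T true 0) {s e : ℕ}
    (ha : Arc T 0 s e) : cnt W false e = cnt W false (e - 1) + 1 := by
  have hb := ha.bounds
  have := cnt_succ_eq (ha.letters h).2
  rwa [Nat.sub_add_cancel (by omega)] at this

/-- The Catalan tableau of a tree. -/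
def tableau (T : PTree) (hT : T ≠ leaf) : CatalanTableau where
  shape := diagram T hT
  filling c := decide (c ∈ rcCells T)
  supp := by
    rintro ⟨i, j⟩ hc
    have h := reads_word hT
    rw [decide_eq_false_iff_not]
    contrapose! hc
    obtain ⟨s, e, ha, h₁, h₂⟩ := (h.mem_rcCells hT _).1 hc
    have hb := ha.bounds
    have hlt := cnt_lt (ha.letters h).1 (show s < e - 1 by omega)
    have hs := h.cnt_arc_end ha
    simp only at h₁ h₂
    rw [mem_diagram, h.mem_shapeCells hT]
    exact ⟨e - 1, by omega, (ha.letters h).2, by omega, by omega⟩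
  shape_nonempty := by
    have h := reads_word hT
    refine ⟨(0, 0), (h.mem_shapeCells_zero hT 0).2 ?_⟩
    exact Nat.zero_lt_of_lt (cnt_lt (h.first (Or.inl rfl)) (numLeaves_pos T))
  leftCol := by
    intro i
    have h := reads_word hT
    rw [decide_eq_false_iff_not, h.mem_rcCells hT]
    rintro ⟨s, e, ha, h₁, h₂⟩
    have := cnt_lt (h.first (Or.inl rfl)) ha.bounds.1
    simp only at h₂
    omega
  colHasOne := by
    intro j hj hlt
    have h := reads_word hT
    rw [rowLen_diagram] at hlt
    obtain ⟨s, hs, hWs, hc⟩ := exists_cnt_eq hlt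
    have hs0 : 0 < s := by
      rcases Nat.eq_zero_or_pos s with rfl | h'
      · simp at hc
        omega
      · exact h'
    obtain ⟨e, ha⟩ := h.exists_arc hWs hs0 (by omega)
    have hb := ha.bounds
    have hle := cnt_mono (word T) false (show e ≤ T.numLeaves by omega)
    refine ⟨cnt (word T) false T.numLeaves - cnt (word T) false e, ?_, fun i hi => ?_⟩
    · simp only [decide_eq_true_eq]
      exact (h.mem_rcCells hT _).2 ⟨s, e, ha, by simp only; omega, hc.symm⟩
    · simp only [decide_eq_true_eq] at hi
      obtain ⟨s', e', ha', h₁, h₂⟩ := (h.mem_rcCells hT _).1 hi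
      obtain rfl : s = s' := cnt_inj hWs (ha'.letters h).1 (hc.trans h₂)
      obtain rfl := ha.eq_end ha'
      simp only at h₁
      omega
  noBadZero := by
    rintro i j hm - ⟨i', hi', h₁⟩ ⟨j', hj', h₂⟩
    have h := reads_word hT
    rw [decide_eq_true_eq, h.mem_rcCells hT] at h₁ h₂
    obtain ⟨s, e, ha, h₃, h₄⟩ := h₁
    obtain ⟨s', e', ha', h₅, h₆⟩ := h₂
    rw [mem_diagram, h.mem_shapeCells hT] at hm
    obtain ⟨q, hq, hWq, hc, hlt⟩ := hm
    simp only at h₃ h₄ h₅ h₆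
    have he' := h.cnt_arc_end ha'
    obtain rfl : q = e' - 1 := cnt_inj hWq (ha'.letters h).2 (by omega)
    have hss : s' < s := by
      by_contra hge
      have := cnt_mono (word T) true (show s ≤ s' by omega)
      omega
    have hse : s < e' := by
      by_contra hge
      have := cnt_mono (word T) true (show e' - 1 ≤ s by omega)
      omega
    have := cnt_mono (word T) false (ha'.noncrossing ha hss hse)
    omega

lemma index_tableau {T : PTree} (hT : T ≠ leaf) :
    (tableau T hT).index = T.numLeaves - 1 := by
  have := cnt_true_add_cnt_false (word T) T.numLeaves
  change (diagram T hT).colLen 0 + (diagram T hT).rowLen 0 - 1 = _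
  rw [rowLen_diagram, colLen_diagram]
  omega

lemma letter_eq_false_of_shapeCells_eq {W W' : ℕ → Bool} {T T' : PTree} (h : Reads W T true 0)
    (h' : Reads W' T' true 0) (hT : T ≠ leaf) (hT' : T' ≠ leaf)
    (hs : shapeCells T = shapeCells T') {q : ℕ} (hq : q < T.numLeaves) (hW : W q = false) :
    W' q = false := by
  have hb : cnt W false T.numLeaves = cnt W' false T'.numLeaves :=
    eq_of_forall_lt_iff fun i => by
      rw [← h.zero_mem_shapeCells hT, ← h'.zero_mem_shapeCells hT', hs]
  have hlt := cnt_lt hW hq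
  obtain ⟨q', hq', hWq', hc⟩ := exists_cnt_eq (hb ▸ hlt)
  have hG : cnt W true q = cnt W' true q' := by
    have key : ∀ j, j < cnt W true q ↔ j < cnt W' true q' := by
      intro j
      have e₁ := h.mem_shapeCells hT (cnt W false T.numLeaves - cnt W false q - 1) j
      have e₂ := h'.mem_shapeCells hT' (cnt W false T.numLeaves - cnt W false q - 1) j
      constructor
      · intro hj
        obtain ⟨k, hk, hWk, hi, hj'⟩ := e₂.1 (hs ▸ e₁.2 ⟨q, hq, hW, by omega, hj⟩)
        obtain rfl : k = q' := cnt_inj hWk hWq' (by omega)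
        exact hj'
      · intro hj
        obtain ⟨k, hk, hWk, hi, hj'⟩ := e₁.1 (hs ▸ e₂.2 ⟨q', hq', hWq', by omega, hj⟩)
        obtain rfl : k = q := cnt_inj hWk hW (by omega)
        exact hj'
    exact eq_of_forall_lt_iff key
  have e₁ := cnt_true_add_cnt_false W q
  have e₂ := cnt_true_add_cnt_false W' q'
  obtain rfl : q = q' := by omega
  exact hWq'

/-- A tree is determined by its number of leaves, shape and marked cells. -/
lemma eq_of_shapeCells_eq {T T' : PTree} (hT : T ≠ leaf) (hT' : T' ≠ leaf)
    (hn : T.numLeaves = T'.numLeaves) (hs : shapeCells T = shapeCells T')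
    (hc : ∀ c, c ∈ rcCells T ↔ c ∈ rcCells T') : T = T' := by
  have h := reads_word hT
  have h' : Reads (word T) T' true 0 := by
    have h'' := reads_word hT'
    rw [Reads, ← h'', ← hn]
    refine List.map_congr_left fun q hq => ?_
    have hq : q < T.numLeaves := by simpa using hq
    have h₁ := letter_eq_false_of_shapeCells_eq h h'' hT hT' hs hq
    have h₂ := letter_eq_false_of_shapeCells_eq h'' h hT' hT hs.symm (hn ▸ hq)
    cases hw : word T q <;> cases hw' : word T' q <;> simp_all
  have key : ∀ {T T' : PTree}, T ≠ leaf → T' ≠ leaf → T.numLeaves = T'.numLeaves →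
      ∀ {W}, Reads W T true 0 → Reads W T' true 0 → (∀ c, c ∈ rcCells T → c ∈ rcCells T') →
      ∀ s e, Arc T 0 s e → Arc T' 0 s e := by
    intro T T' hT hT' hn W h h' hc s e ha
    have hb := ha.bounds
    have hle := cnt_mono W false (show e ≤ T.numLeaves by omega)
    obtain ⟨s', e', ha', h₁, h₂⟩ := (h'.mem_rcCells hT' _).1 <|
      hc (cnt W false T.numLeaves - cnt W false e, cnt W true s) <|
        (h.mem_rcCells hT _).2 ⟨s, e, ha, by simp only; omega, rfl⟩
    have hb' := ha'.bounds
    rw [← hn] at h₁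
    simp only at h₁ h₂
    have e₁ := h.cnt_arc_end ha
    have e₂ := h'.cnt_arc_end ha'
    have es := cnt_inj (ha.letters h).1 (ha'.letters h').1 h₂
    have ee := cnt_inj (ha.letters h).2 (ha'.letters h').2 (by omega)
    obtain rfl : e = e' := by omega
    subst es
    exact ha'
  exact eq_of_arc_iff hn fun s e =>
    ⟨key hT hT' hn h h' (fun c => (hc c).1) s e, key hT' hT hn.symm h' h (fun c => (hc c).2) s e⟩

end PTree

namespace CatalanTableau

open PTree

lemma rowLen_pos (t : CatalanTableau) : 0 < t.shape.rowLen 0 := by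
  obtain ⟨c, hc⟩ := t.shape_nonempty
  exact YoungDiagram.mem_iff_lt_rowLen.1
    (t.shape.up_left_mem (Nat.zero_le c.1) (Nat.zero_le c.2) hc)

lemma colLen_pos (t : CatalanTableau) : 0 < t.shape.colLen 0 := by
  obtain ⟨c, hc⟩ := t.shape_nonempty
  exact YoungDiagram.mem_iff_lt_colLen.1
    (t.shape.up_left_mem (Nat.zero_le c.1) (Nat.zero_le c.2) hc)

end CatalanTableau

open PTree in
/-- The boundary path of a Young diagram, as a word. -/
lemma YoungDiagram.exists_word (μ : YoungDiagram) :
    ∃ W : ℕ → Bool, W 0 = true ∧ cnt W false (μ.colLen 0 + μ.rowLen 0) = μ.colLen 0 ∧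
      ∀ i j, (i, j) ∈ μ ↔ ∃ q < μ.colLen 0 + μ.rowLen 0, W q = false ∧
        i + cnt W false q + 1 = μ.colLen 0 ∧ j < cnt W true q := by
  classical
  set b := μ.colLen 0 with hb
  set pos : ℕ → ℕ := fun f => μ.rowLen (b - 1 - f) + f with hpos
  have hmono : StrictMono pos := by
    refine strictMono_nat_of_lt_succ fun f => ?_
    have := μ.rowLen_anti (b - 1 - (f + 1)) (b - 1 - f) (by omega)
    simp only [hpos]
    omega
  have hrow : ∀ f < b, 0 < μ.rowLen (b - 1 - f) := fun f hf =>
    YoungDiagram.mem_iff_lt_rowLen.1 (YoungDiagram.mem_iff_lt_colLen.2 (by omega))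
  set W : ℕ → Bool := fun k => !decide (∃ f < b, k = pos f) with hW
  have hWf : ∀ k, W k = false ↔ ∃ f < b, k = pos f := fun k => by simp [hW]
  have hcnt : ∀ f ≤ b, ∀ k, (∀ f' < b, pos f' < k ↔ f' < f) → cnt W false k = f := by
    intro f hf k hk
    rw [cnt, Nat.count_eq_card_filter_range]
    have : (Finset.range k).filter (fun i => W i = false) = (Finset.range f).image pos := by
      ext x
      simp only [Finset.mem_filter, Finset.mem_range, Finset.mem_image, hWf]
      constructor
      · rintro ⟨hx, f', hf', rfl⟩
        exact ⟨f', (hk f' hf').1 hx, rfl⟩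
      · rintro ⟨f', hf', rfl⟩
        exact ⟨(hk f' (by omega)).2 hf', f', by omega, rfl⟩
    rw [this, Finset.card_image_of_injective _ hmono.injective, Finset.card_range]
  have hH : ∀ f < b, cnt W false (pos f) = f := fun f hf =>
    hcnt f hf.le _ fun f' _ => hmono.lt_iff_lt
  have hG : ∀ f < b, cnt W true (pos f) = μ.rowLen (b - 1 - f) := by
    intro f hf
    have h₁ := cnt_true_add_cnt_false W (pos f)
    rw [hH f hf] at h₁
    simp only [hpos] at h₁ ⊢
    omega
  have hbd : ∀ f < b, pos f < b + μ.rowLen 0 := by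
    intro f hf
    have := μ.rowLen_anti 0 (b - 1 - f) (Nat.zero_le _)
    simp only [hpos]
    omega
  refine ⟨W, ?_, hcnt b le_rfl _ fun f' hf' => ⟨fun _ => hf', fun _ => hbd f' hf'⟩,
    fun i j => ⟨fun hm => ?_, ?_⟩⟩
  · by_contra h
    obtain ⟨f, hf, h0⟩ := (hWf 0).1 (by simpa using h)
    have := hrow f hf
    simp only [hpos] at h0
    omega
  · have hi : i < b := YoungDiagram.mem_iff_lt_colLen.1
      (μ.up_left_mem le_rfl (Nat.zero_le j) hm)
    refine ⟨pos (b - 1 - i), hbd _ (by omega), (hWf _).2 ⟨_, by omega, rfl⟩, ?_, ?_⟩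
    · rw [hH _ (by omega)]
      omega
    · rw [hG _ (by omega), show b - 1 - (b - 1 - i) = i by omega]
      exact YoungDiagram.mem_iff_lt_rowLen.1 hm
  · rintro ⟨q, -, hq, hi, hj⟩
    obtain ⟨f, hf, rfl⟩ := (hWf q).1 hq
    rw [hH f hf] at hi
    rw [hG f hf] at hj
    rw [YoungDiagram.mem_iff_lt_rowLen]
    rwa [show b - 1 - f = i by omega] at hj

namespace CatalanTableau

open PTree

/-- Every Catalan tableau comes from a tree. -/
lemma exists_tree (t : CatalanTableau) :
    ∃ T : PTree, T ≠ .leaf ∧ T.numLeaves = t.shape.colLen 0 + t.shape.rowLen 0 ∧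
      shapeCells T = t.shape.cells ∧ ∀ c, c ∈ rcCells T ↔ t.filling c = true := by
  have ha := t.rowLen_pos
  have hb := t.colLen_pos
  obtain ⟨W, hW0, hWb, hsh⟩ := t.shape.exists_word
  set N := t.shape.colLen 0 + t.shape.rowLen 0 with hN
  set b := t.shape.colLen 0
  have hWa : cnt W true N = t.shape.rowLen 0 := by
    have := cnt_true_add_cnt_false W N
    omega
  have hsupp : ∀ {c}, t.filling c = true → c ∈ t.shape := fun {c} h => by
    by_contra hc
    simp [t.supp c hc] at h
  have hcol : ∀ {i i' j}, t.filling (i, j) = true → t.filling (i', j) = true → i = i' := by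
    intro i i' j h h'
    have hj : 0 < j := by
      rcases Nat.eq_zero_or_pos j with rfl | hj
      · simp [t.leftCol i] at h
      · exact hj
    exact (t.colHasOne j hj (YoungDiagram.mem_iff_lt_rowLen.1
      (t.shape.up_left_mem (Nat.zero_le i) le_rfl (hsupp h)))).unique h h'
  set R : ℕ → ℕ → Prop := fun s e => W s = true ∧ s + 1 < e ∧ e ≤ N ∧ W (e - 1) = false ∧
    t.filling (b - cnt W false e, cnt W true s) = true with hR
  have hend : ∀ {s e}, R s e → cnt W false e = cnt W false (e - 1) + 1 ∧ cnt W false e ≤ b := by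
    rintro s e ⟨_, h₁, h₂, h₃, _⟩
    have h := cnt_succ_eq h₃
    rw [Nat.sub_add_cancel (by omega)] at h
    exact ⟨h, hWb ▸ cnt_mono W false h₂⟩
  have hfill : ∀ {i s}, W s = true → t.filling (i, cnt W true s) = true →
      ∃ e, R s e ∧ i + cnt W false e = b := by
    intro i s hs hf
    obtain ⟨q, hq, hWq, hi, hlt⟩ := (hsh _ _).1 (hsupp hf)
    have hsq : s < q := by
      by_contra hge
      have := cnt_mono W true (show q ≤ s by omega)
      omega
    have h := cnt_succ_eq hWq
    refine ⟨q + 1, ⟨hs, by omega, by omega, by simpa using hWq, ?_⟩, by omega⟩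
    rwa [show b - cnt W false (q + 1) = i by omega]
  obtain ⟨T, hTn, hTW, hTA⟩ := PTree.exists_tree (W := W) (R := R) (fun s e h => h.1)
    (fun s e h => h.2.1) (by
      intro s e e' h h'
      have h₁ := hcol h.2.2.2.2 h'.2.2.2.2
      have h₂ := hend h
      have h₃ := hend h'
      have := cnt_inj h.2.2.2.1 h'.2.2.2.1 (by omega)
      have := h.2.1
      have := h'.2.1
      omega) (by
      intro s e s' e' h h' hlt hlt'
      by_contra hgt
      have h₂ := hend h
      have h₃ := hend h'
      have hse : s' < e - 1 := by
        rcases Nat.lt_or_ge s' (e - 1) with h₄ | h₄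
        · exact h₄
        · obtain rfl : s' = e - 1 := by omega
          exact absurd (h.2.2.2.1.symm.trans h'.1) (by simp)
      have hee := cnt_lt h.2.2.2.1 (show e - 1 < e' - 1 by omega)
      have hm : (b - cnt W false e, cnt W true s') ∈ t.shape :=
        (hsh _ _).2 ⟨e - 1, by have := h.2.2.1; omega, h.2.2.2.1, by omega, cnt_lt h'.1 hse⟩
      by_cases hf : t.filling (b - cnt W false e, cnt W true s') = true
      · have := hcol hf h'.2.2.2.2
        omega
      · exact t.noBadZero _ _ hm (by simpa using hf) ⟨_, by omega, h'.2.2.2.2⟩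
          ⟨_, cnt_lt h.1 hlt, h.2.2.2.2⟩) N 0 (by omega) hW0 (by
      intro s h₁ h₂ hs
      have h₃ := cnt_lt hW0 h₁
      have h₄ := cnt_lt hs (show s < N by omega)
      obtain ⟨i, hi, -⟩ := t.colHasOne (cnt W true s) (by omega) (by omega)
      obtain ⟨e, he, -⟩ := hfill hs hi
      exact ⟨e, by have := he.2.2.1; omega, he⟩)
  have hT : T ≠ leaf := by
    rintro rfl
    simp only [numLeaves] at hTn
    omega
  refine ⟨T, hT, hTn, ?_, ?_⟩
  · ext ⟨i, j⟩
    rw [hTW.mem_shapeCells hT, YoungDiagram.mem_cells, hsh, hTn, hWb]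
  · rintro ⟨i, j⟩
    rw [hTW.mem_rcCells hT, hTn, hWb]
    constructor
    · rintro ⟨s, e, hA, h₁, h₂⟩
      have h := ((hTA s e).1 hA).1
      simp only at h₁ h₂
      rw [h₂, show i = b - cnt W false e by omega]
      exact h.2.2.2.2
    · intro hf
      have hj : j < cnt W true N := by
        rw [hWa]
        exact YoungDiagram.mem_iff_lt_rowLen.1
          (t.shape.up_left_mem (Nat.zero_le i) le_rfl (hsupp hf))
      obtain ⟨s, hs, hWs, rfl⟩ := exists_cnt_eq hj
      have hs0 : 0 < s := by
        rcases Nat.eq_zero_or_pos s with rfl | h'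
        · simp [t.leftCol i] at hf
        · exact h'
      obtain ⟨e, he, hi⟩ := hfill hWs hf
      exact ⟨s, e, (hTA s e).2 ⟨he, hs0, by have := he.2.2.1; omega⟩, hi, rfl⟩

lemma eq_of_shape_of_filling {t t' : CatalanTableau} (hs : t.shape = t'.shape)
    (hf : t.filling = t'.filling) : t = t' := by
  cases t
  cases t'
  subst hs hf
  rfl

end CatalanTableau

/-- the map `φ` (lattice-path shape `λ(T)` together with a 1 in
exactly the pattern cells of the embedded rotated tree) is a bijection from
`T_n` onto the set of Catalan tableaux of index `n+1`. -/
theorem phi_bijection (n : ℕ) :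
    ∃ φ : {T : PTree // T.numLeaves = n + 2} → {t : CatalanTableau // t.index = n + 1},
      Function.Bijective φ ∧
      ∀ T, (φ T).val.shape.cells = PTree.shapeCells T.val ∧
        ∀ c, (φ T).val.filling c = decide (c ∈ PTree.rcCells T.val) := by
  have hne : ∀ T : {T : PTree // T.numLeaves = n + 2}, T.val ≠ .leaf := by
    rintro ⟨T, hT⟩ rfl
    simp [PTree.numLeaves] at hT
  refine ⟨fun T => ⟨PTree.tableau T.val (hne T), ?_⟩, ⟨?_, ?_⟩, fun T => ⟨rfl, fun c => rfl⟩⟩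
  · rw [PTree.index_tableau, T.property]
    rfl
  · intro T T' h
    have h' : PTree.tableau T.val (hne T) = PTree.tableau T'.val (hne T') := congrArg Subtype.val h
    refine Subtype.ext (PTree.eq_of_shapeCells_eq (hne T) (hne T')
      (T.property.trans T'.property.symm) (congrArg (fun t => t.shape.cells) h') fun c => ?_)
    exact decide_eq_decide.1 (congrArg (fun t => t.filling c) h')
  · rintro ⟨t, ht⟩
    obtain ⟨T, hT, hn, hs, hf⟩ := t.exists_tree
    have := t.rowLen_pos
    rw [CatalanTableau.index] at ht
    refine ⟨⟨T, by omega⟩, Subtype.ext (CatalanTableau.eq_of_shape_of_filling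
      (YoungDiagram.ext hs) (funext fun c => ?_))⟩
    rw [Bool.eq_iff_iff, ← hf c]
    exact decide_eq_true_iff
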